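/- Let s₁ ≤ s₂ ≤ … ≤ sₙ be strings over a linearly ordered alphabet sorted in lexicographic order, let P be a string, and let r be an index with sᵣ ≤ P in lexicographic order. Then for every q < r, lcp(P, s_q) = min(lcp(P, sᵣ), lcp(sᵣ, s_q)). Symmetrically, if P ≤ sᵣ, then for every q > r, lcp(P, s_q) = min(lcp(P, sᵣ), lcp(sᵣ, s_q)). -/

import Mathlib

/-- `lcp a b` is the length of the longest common prefix of the strings
(lists) `a` and `b`. -/
def lcp {α : Type} [DecidableEq α] : List α → List α → ℕ
  | a :: as, b :: bs => if a = b then lcp as bs + 1 else 0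
  | _, _ => 0

theorem lcp_symm_aux {α : Type} [DecidableEq α] : ∀ a b : List α, lcp a b = lcp b a
  | [], [] => rfl
  | [], _ :: _ => rfl
  | _ :: _, [] => rfl
  | a :: as, b :: bs => by
    have := lcp_symm_aux as bs
    simp only [lcp, eq_comm (a := b), this]

theorem lcp_mid_aux {α : Type} [LinearOrder α] : ∀ a b c : List α, a ≤ b → b ≤ c →
    lcp a c = min (lcp a b) (lcp b c)
  | [], b, c, _, _ => by simp [lcp]
  | a :: as, [], c, h, _ => absurd h (by simp)
  | a :: as, b :: bs, [], _, h => absurd h (by simp)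
  | a :: as, b :: bs, c :: cs, h1, h2 => by
    have ih := lcp_mid_aux as bs cs
    have key : ∀ (x y : α) (xs ys : List α), x :: xs ≤ y :: ys → x < y ∨ x = y ∧ xs ≤ ys := by
      intro x y xs ys h
      rcases lt_trichotomy x y with hxy | rfl | hxy
      · exact Or.inl hxy
      · refine Or.inr ⟨rfl, ?_⟩
        by_contra hc
        exact absurd h (not_le.mpr (List.Lex.cons (not_le.mp hc)))
      · exact absurd h (not_le.mpr (List.Lex.rel hxy))
    replace h1 := key _ _ _ _ h1
    replace h2 := key _ _ _ _ h2
    simp only [lcp]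
    rcases h1 with h1 | ⟨rfl, h1⟩
    · rcases h2 with h2 | ⟨rfl, h2⟩
      · simp [h1.ne, h2.ne, (h1.trans h2).ne]
      · simp [h1.ne]
    · rcases h2 with h2 | ⟨rfl, h2⟩
      · simp [h2.ne]
      · simp [ih h1 h2]

/-- Let `s 0 ≤ s 1 ≤ … ` be lexicographically sorted strings, `P` a string, and
`r` an index. If `s r ≤ P`, then for every `q < r`,
`lcp(P, s q) = min(lcp(P, s r), lcp(s r, s q))`; symmetrically, if `P ≤ s r`,
then for every `q > r`, `lcp(P, s q) = min(lcp(P, s r), lcp(s r, s q))`. -/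
theorem stmt9 {α : Type} [LinearOrder α] {n : ℕ} (s : Fin n → List α)
    (hs : Monotone s) (P : List α) (r : Fin n) :
    (s r ≤ P → ∀ q : Fin n, q < r →
      lcp P (s q) = min (lcp P (s r)) (lcp (s r) (s q))) ∧
    (P ≤ s r → ∀ q : Fin n, r < q →
      lcp P (s q) = min (lcp P (s r)) (lcp (s r) (s q))) := by
  refine ⟨fun h q hq => ?_, fun h q hq => lcp_mid_aux _ _ _ h (hs hq.le)⟩
  rw [lcp_symm_aux P (s q), lcp_symm_aux P (s r), lcp_symm_aux (s r) (s q), min_comm]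
  exact lcp_mid_aux _ _ _ (hs hq.le) h
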